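/- arXiv:2307.16158 — 3 statements merged into one kernel-verified Lean document; each statement's English description precedes it below -/
import Mathlib

section
/- Korn's inequality for the Biot poroviscoelastic domain (Proposition 'Korn'): Let L, R > 0 and let η = (η₁, η₂) : ℝ² → ℝ² be twice continuously differentiable on a neighborhood of the closed rectangle [0,L] × [0,R]. Suppose η(x,y) = 0 whenever (x,y) lies on the left, right, or top side of the rectangle (i.e. x = 0, x = L, or y = R with 0 ≤ x ≤ L, 0 ≤ y ≤ R), and η₁(x,0) = 0 for all 0 ≤ x ≤ L. Then ∫_{Ω_b} |D(η)|² ≥ (1/2) ∫_{Ω_b} |∇η|². -/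
open MeasureTheory Set

/-- If `u` vanishes along the segment from `(a, c)` to `(b, c)`, so does its tangential
derivative in the interior of that segment. -/
lemma fderiv_apply_fst_eq_zero {u : ℝ × ℝ → ℝ} {a b c x : ℝ}
    (hu : DifferentiableAt ℝ u (x, c)) (hx : x ∈ Ioo a b)
    (h0 : ∀ t ∈ Icc a b, u (t, c) = 0) :
    fderiv ℝ u (x, c) (1, 0) = 0 := by
  have h1 : HasDerivAt (fun t : ℝ => u (t, c)) (fderiv ℝ u (x, c) (1, 0)) x :=
    hu.hasFDerivAt.comp_hasDerivAt (f := fun t : ℝ => (t, c)) x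
      ((hasDerivAt_id x).prodMk (hasDerivAt_const x c))
  have h2 : HasDerivAt (fun t : ℝ => u (t, c)) 0 x := by
    refine (hasDerivAt_const x (0 : ℝ)).congr_of_eventuallyEq ?_
    filter_upwards [Icc_mem_nhds hx.1 hx.2] with t ht using h0 t ht
  exact h1.unique h2

/-- The Jacobian determinant of `(u, v)` integrates to zero over a rectangle if `v` vanishes on
the left, right and top sides and `u` vanishes on the bottom side. -/
lemma setIntegral_jacobian_eq_zero {L R : ℝ} (hL : 0 ≤ L) (hR : 0 ≤ R) {u v : ℝ × ℝ → ℝ}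
    {U : Set (ℝ × ℝ)} (hU : IsOpen U) (hsub : Icc (0 : ℝ) L ×ˢ Icc (0 : ℝ) R ⊆ U)
    (hu : ContDiffOn ℝ 2 u U) (hv : ContDiffOn ℝ 1 v U)
    (hside : ∀ x y : ℝ, x ∈ Icc (0 : ℝ) L → y ∈ Icc (0 : ℝ) R →
      (x = 0 ∨ x = L ∨ y = R) → v (x, y) = 0)
    (hbottom : ∀ x ∈ Icc (0 : ℝ) L, u (x, 0) = 0) :
    ∫ p in Icc (0 : ℝ) L ×ˢ Icc (0 : ℝ) R,
      (fderiv ℝ u p (0, 1) * fderiv ℝ v p (1, 0) -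
        fderiv ℝ u p (1, 0) * fderiv ℝ v p (0, 1)) = 0 := by
  have hdu : ContDiffOn ℝ 1 (fderiv ℝ u) U := hu.fderiv_of_isOpen hU (by norm_num)
  have hcu : ∀ w, ContinuousOn (fun p => fderiv ℝ u p w) U := fun w =>
    hdu.continuousOn.clm_apply continuousOn_const
  have hcv : ∀ w, ContinuousOn (fun p => fderiv ℝ v p w) U := fun w =>
    (hv.continuousOn_fderiv_of_isOpen hU le_rfl).clm_apply continuousOn_const
  have hprod : ∀ w, ∀ p ∈ U, HasFDerivAt (fun q => v q * fderiv ℝ u q w)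
      (v p • (fderiv ℝ (fderiv ℝ u) p).flip w + fderiv ℝ u p w • fderiv ℝ v p) p := by
    intro w p hp
    have hd : DifferentiableAt ℝ (fderiv ℝ u) p :=
      (hdu.contDiffAt (hU.mem_nhds hp)).differentiableAt one_ne_zero
    have hd' : HasFDerivAt (fun q => fderiv ℝ u q w) ((fderiv ℝ (fderiv ℝ u) p).flip w) p :=
      (ContinuousLinearMap.apply ℝ ℝ w).hasFDerivAt.comp p hd.hasFDerivAt
    exact (((hv.contDiffAt (hU.mem_nhds hp)).differentiableAt one_ne_zero).hasFDerivAt).mul hd'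
  have hdiv : ∀ p ∈ U,
      (v p • (fderiv ℝ (fderiv ℝ u) p).flip (0, 1) +
          fderiv ℝ u p (0, 1) • fderiv ℝ v p) (1, 0) +
        (-(v p • (fderiv ℝ (fderiv ℝ u) p).flip (1, 0) +
          fderiv ℝ u p (1, 0) • fderiv ℝ v p)) (0, 1) =
      fderiv ℝ u p (0, 1) * fderiv ℝ v p (1, 0) -
        fderiv ℝ u p (1, 0) * fderiv ℝ v p (0, 1) := by
    intro p hp
    have hsymm := ((hu.contDiffAt (hU.mem_nhds hp)).isSymmSndFDerivAt (by simp)).eq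
      ((1 : ℝ), (0 : ℝ)) (0, 1)
    simp only [add_apply, neg_apply,
      smul_apply, ContinuousLinearMap.flip_apply, smul_eq_mul, hsymm]
    ring
  have hIcc : Icc ((0 : ℝ), (0 : ℝ)) (L, R) = Icc (0 : ℝ) L ×ˢ Icc (0 : ℝ) R :=
    (Icc_prod_Icc 0 L 0 R).symm
  have hIoo : Ioo (0 : ℝ) L ×ˢ Ioo (0 : ℝ) R ⊆ U :=
    (prod_mono Ioo_subset_Icc_self Ioo_subset_Icc_self).trans hsub
  have hcont : ∀ w, ContinuousOn (fun q => v q * fderiv ℝ u q w) U := fun w =>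
    hv.continuousOn.mul (hcu w)
  have key := integral_divergence_prod_Icc_of_hasFDerivAt_of_le
    (fun q => v q * fderiv ℝ u q (0, 1)) (fun q => -(v q * fderiv ℝ u q (1, 0)))
    _ _ ((0 : ℝ), (0 : ℝ)) (L, R) ⟨hL, hR⟩
    (by rw [hIcc]; exact (hcont _).mono hsub) (by rw [hIcc]; exact ((hcont _).mono hsub).neg)
    (fun p hp => hprod (0, 1) p (hIoo hp)) (fun p hp => (hprod (1, 0) p (hIoo hp)).neg)
    (by
      rw [hIcc]
      refine IntegrableOn.congr_fun (f := fun p => fderiv ℝ u p (0, 1) * fderiv ℝ v p (1, 0) -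
        fderiv ℝ u p (1, 0) * fderiv ℝ v p (0, 1)) ?_ (fun p hp => (hdiv p (hsub hp)).symm)
        (measurableSet_Icc.prod measurableSet_Icc)
      exact ((((hcu _).mul (hcv _)).sub ((hcu _).mul (hcv _))).mono hsub).integrableOn_compact
        (isCompact_Icc.prod isCompact_Icc))
  rw [hIcc, setIntegral_congr_fun (measurableSet_Icc.prod measurableSet_Icc)
    (fun p hp => hdiv p (hsub hp))] at key
  rw [key]
  have htop : ∫ x in (0 : ℝ)..L, -(v (x, R) * fderiv ℝ u (x, R) (1, 0)) = 0 := by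
    refine (intervalIntegral.integral_congr (g := fun _ => 0) fun x hx => ?_).trans (by simp)
    rw [uIcc_of_le hL] at hx
    simp [hside x R hx ⟨hR, le_rfl⟩]
  have hbot : ∫ x in (0 : ℝ)..L, -(v (x, 0) * fderiv ℝ u (x, 0) (1, 0)) = 0 := by
    refine (intervalIntegral.integral_congr (g := fun _ => 0) fun x hx => ?_).trans (by simp)
    rw [uIcc_of_le hL] at hx
    have h0 : (0 : ℝ) ∈ Icc 0 R := ⟨le_rfl, hR⟩
    rcases hx.1.eq_or_lt with h | h
    · simp [hside x 0 hx h0 (.inl h.symm)]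
    rcases hx.2.eq_or_lt with h' | h'
    · simp [hside x 0 hx h0 (.inr (.inl h'))]
    have hd : DifferentiableAt ℝ u (x, 0) :=
      (hu.contDiffAt (hU.mem_nhds (hsub ⟨hx, h0⟩))).differentiableAt two_ne_zero
    simp [fderiv_apply_fst_eq_zero hd ⟨h, h'⟩ hbottom]
  have hvert : ∀ x ∈ Icc (0 : ℝ) L, x = 0 ∨ x = L →
      ∫ y in (0 : ℝ)..R, v (x, y) * fderiv ℝ u (x, y) (0, 1) = 0 := by
    intro x hx hx'
    refine (intervalIntegral.integral_congr (g := fun _ => 0) fun y hy => ?_).trans (by simp)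
    rw [uIcc_of_le hR] at hy
    simp [hside x y hx hy (by tauto)]
  simp [htop, hbot, hvert L ⟨hL, le_rfl⟩ (.inr rfl), hvert 0 ⟨le_rfl, hL⟩ (.inl rfl),
    -intervalIntegral.integral_neg]

/-- Korn's inequality for the Biot poroviscoelastic domain. -/
theorem korn_inequality_biot
    (L R : ℝ) (hL : 0 < L) (hR : 0 < R)
    (η : ℝ × ℝ → ℝ × ℝ)
    (U : Set (ℝ × ℝ)) (hUopen : IsOpen U)
    (hUsub : Icc (0:ℝ) L ×ˢ Icc (0:ℝ) R ⊆ U)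
    (hη : ContDiffOn ℝ 2 η U)
    (hside : ∀ x y : ℝ, x ∈ Icc (0:ℝ) L → y ∈ Icc (0:ℝ) R →
      (x = 0 ∨ x = L ∨ y = R) → η (x, y) = 0)
    (hbottom : ∀ x ∈ Icc (0:ℝ) L, (η (x, 0)).1 = 0) :
    (1 / 2) * (∫ p in Ioo (0:ℝ) L ×ˢ Ioo (0:ℝ) R,
        ((fderiv ℝ (fun q => (η q).1) p ((1:ℝ), (0:ℝ))) ^ 2 +
          (fderiv ℝ (fun q => (η q).1) p ((0:ℝ), (1:ℝ))) ^ 2 +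
          (fderiv ℝ (fun q => (η q).2) p ((1:ℝ), (0:ℝ))) ^ 2 +
          (fderiv ℝ (fun q => (η q).2) p ((0:ℝ), (1:ℝ))) ^ 2))
      ≤ ∫ p in Ioo (0:ℝ) L ×ˢ Ioo (0:ℝ) R,
          ((fderiv ℝ (fun q => (η q).1) p ((1:ℝ), (0:ℝ))) ^ 2 +
            (fderiv ℝ (fun q => (η q).2) p ((0:ℝ), (1:ℝ))) ^ 2 +
            2 * ((1 / 2) * (fderiv ℝ (fun q => (η q).1) p ((0:ℝ), (1:ℝ)) +
              fderiv ℝ (fun q => (η q).2) p ((1:ℝ), (0:ℝ)))) ^ 2) := by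
  have hu : ContDiffOn ℝ 2 (fun q => (η q).1) U := hη.fst
  have hv : ContDiffOn ℝ 2 (fun q => (η q).2) U := hη.snd
  have hjac := setIntegral_jacobian_eq_zero hL.le hR.le hUopen hUsub hu
    (hv.of_le one_le_two)
    (fun x y hx hy h => by simp [hside x y hx hy h]) hbottom
  have hcu : ∀ w, ContinuousOn (fun p => fderiv ℝ (fun q => (η q).1) p w)
      (Icc (0 : ℝ) L ×ˢ Icc (0 : ℝ) R) := fun w =>
    ((hu.continuousOn_fderiv_of_isOpen hUopen one_le_two).clm_apply continuousOn_const).mono hUsub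
  have hcv : ∀ w, ContinuousOn (fun p => fderiv ℝ (fun q => (η q).2) p w)
      (Icc (0 : ℝ) L ×ˢ Icc (0 : ℝ) R) := fun w =>
    ((hv.continuousOn_fderiv_of_isOpen hUopen one_le_two).clm_apply continuousOn_const).mono hUsub
  have hK : IsCompact (Icc (0 : ℝ) L ×ˢ Icc (0 : ℝ) R) := isCompact_Icc.prod isCompact_Icc
  have hae : (Ioo (0 : ℝ) L ×ˢ Ioo (0 : ℝ) R : Set (ℝ × ℝ)) =ᵐ[volume]
      (Icc (0 : ℝ) L ×ˢ Icc (0 : ℝ) R : Set (ℝ × ℝ)) :=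
    Measure.set_prod_ae_eq Ioo_ae_eq_Icc Ioo_ae_eq_Icc
  rw [setIntegral_congr_set hae, setIntegral_congr_set hae]
  generalize fderiv ℝ (fun q => (η q).1) = du at *
  generalize fderiv ℝ (fun q => (η q).2) = dv at *
  rw [← integral_const_mul]
  refine (((add_zero _).symm.trans (congrArg _ hjac.symm)).trans
    (integral_add ?_ ?_).symm).trans_le (integral_mono ?_ ?_ fun p => ?_)
  case refine_5 =>
    dsimp only
    nlinarith [sq_nonneg (du p (1, 0) + dv p (0, 1))]
  all_goals exact ContinuousOn.integrableOn_compact hK (by fun_prop)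
end

section
/- Transformed divergence under the ALE map: Let R > 0 and let ω : ℝ → ℝ be continuously differentiable with R + ω(x̂) > 0 for all x̂. Define the ALE map Φ(x̂,ŷ) := (x̂, ŷ + (1 + ŷ/R)·ω(x̂)). Let u = (u₁,u₂) : ℝ² → ℝ² be continuously differentiable and set û := u ∘ Φ. Then for every (x̂,ŷ): (∂u₁/∂x + ∂u₂/∂y)(Φ(x̂,ŷ)) = ∂û₁/∂x̂ (x̂,ŷ) − ((R + ŷ)·ω'(x̂)/(R + ω(x̂)))·∂û₁/∂ŷ (x̂,ŷ) + (R/(R + ω(x̂)))·∂û₂/∂ŷ (x̂,ŷ). In particular, u is divergence-free at Φ(x̂,ŷ) if and only if the transformed divergence ∇̂^ω_f · û vanishes at (x̂,ŷ). -/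
/-- The Fréchet derivative of the ALE map. -/
theorem hasFDerivAt_aleMap (R : ℝ) {ω : ℝ → ℝ} {p : ℝ × ℝ} (hω : DifferentiableAt ℝ ω p.1) :
    HasFDerivAt (fun q : ℝ × ℝ => (q.1, q.2 + (1 + q.2 / R) * ω q.1))
      ((ContinuousLinearMap.fst ℝ ℝ ℝ).prod
        (((1 + p.2 / R) * deriv ω p.1) • ContinuousLinearMap.fst ℝ ℝ ℝ +
          (1 + ω p.1 / R) • ContinuousLinearMap.snd ℝ ℝ ℝ)) p := by
  have hω' : HasFDerivAt (fun q : ℝ × ℝ => ω q.1)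
      (deriv ω p.1 • ContinuousLinearMap.fst ℝ ℝ ℝ) p :=
    hω.hasDerivAt.comp_hasFDerivAt p hasFDerivAt_fst
  have hy : HasFDerivAt (fun q : ℝ × ℝ => 1 + q.2 / R)
      (R⁻¹ • ContinuousLinearMap.snd ℝ ℝ ℝ) p := by
    simpa [div_eq_mul_inv] using
      ((hasFDerivAt_snd (𝕜 := ℝ) (p := p)).mul_const R⁻¹).const_add 1
  refine hasFDerivAt_fst.prodMk ((hasFDerivAt_snd.add (hy.mul hω')).congr_fderiv ?_)
  ext
  · simp
  · simp
    ring

/-- The chain rule for partial derivatives of a scalar function composed with the ALE map. -/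
theorem fderiv_comp_aleMap (R : ℝ) {ω : ℝ → ℝ} {f : ℝ × ℝ → ℝ} {p : ℝ × ℝ}
    (hω : DifferentiableAt ℝ ω p.1)
    (hf : DifferentiableAt ℝ f (p.1, p.2 + (1 + p.2 / R) * ω p.1)) :
    fderiv ℝ (fun q : ℝ × ℝ => f (q.1, q.2 + (1 + q.2 / R) * ω q.1)) p (1, 0) =
        fderiv ℝ f (p.1, p.2 + (1 + p.2 / R) * ω p.1) (1, 0) +
          (1 + p.2 / R) * deriv ω p.1 *
            fderiv ℝ f (p.1, p.2 + (1 + p.2 / R) * ω p.1) (0, 1) ∧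
      fderiv ℝ (fun q : ℝ × ℝ => f (q.1, q.2 + (1 + q.2 / R) * ω q.1)) p (0, 1) =
        (1 + ω p.1 / R) * fderiv ℝ f (p.1, p.2 + (1 + p.2 / R) * ω p.1) (0, 1) := by
  have h := hf.hasFDerivAt.comp p (hasFDerivAt_aleMap R hω)
  have hlin (L : ℝ × ℝ →L[ℝ] ℝ) (a b : ℝ) : L (a, b) = a * L (1, 0) + b * L (0, 1) := by
    rw [← smul_eq_mul, ← smul_eq_mul, ← map_smul, ← map_smul, ← map_add]
    simp
  have h' := h.fderiv
  simp only [Function.comp_def] at h'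
  rw [h']
  constructor
  · simpa using hlin _ 1 ((1 + p.2 / R) * deriv ω p.1)
  · simpa using hlin _ 0 (1 + ω p.1 / R)

/-- Transformed divergence under the ALE map. -/
theorem ale_transformed_divergence
    (R : ℝ) (hR : 0 < R)
    (ω : ℝ → ℝ) (hω : ContDiff ℝ 1 ω)
    (hpos : ∀ x : ℝ, 0 < R + ω x)
    (u : ℝ × ℝ → ℝ × ℝ) (hu : ContDiff ℝ 1 u)
    (Φ : ℝ × ℝ → ℝ × ℝ)
    (hΦ : ∀ p : ℝ × ℝ, Φ p = (p.1, p.2 + (1 + p.2 / R) * ω p.1))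
    (uh : ℝ × ℝ → ℝ × ℝ) (huh : ∀ p : ℝ × ℝ, uh p = u (Φ p)) :
    (∀ p : ℝ × ℝ,
      fderiv ℝ (fun q => (u q).1) (Φ p) ((1:ℝ), (0:ℝ)) +
          fderiv ℝ (fun q => (u q).2) (Φ p) ((0:ℝ), (1:ℝ)) =
        fderiv ℝ (fun q => (uh q).1) p ((1:ℝ), (0:ℝ)) -
          ((R + p.2) * deriv ω p.1 / (R + ω p.1)) *
            fderiv ℝ (fun q => (uh q).1) p ((0:ℝ), (1:ℝ)) +
          (R / (R + ω p.1)) * fderiv ℝ (fun q => (uh q).2) p ((0:ℝ), (1:ℝ))) ∧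
    (∀ p : ℝ × ℝ,
      (fderiv ℝ (fun q => (u q).1) (Φ p) ((1:ℝ), (0:ℝ)) +
          fderiv ℝ (fun q => (u q).2) (Φ p) ((0:ℝ), (1:ℝ)) = 0) ↔
        (fderiv ℝ (fun q => (uh q).1) p ((1:ℝ), (0:ℝ)) -
          ((R + p.2) * deriv ω p.1 / (R + ω p.1)) *
            fderiv ℝ (fun q => (uh q).1) p ((0:ℝ), (1:ℝ)) +
          (R / (R + ω p.1)) * fderiv ℝ (fun q => (uh q).2) p ((0:ℝ), (1:ℝ)) = 0)) := by
  obtain rfl : Φ = fun p => (p.1, p.2 + (1 + p.2 / R) * ω p.1) := funext hΦ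
  obtain rfl : uh = fun p => u (p.1, p.2 + (1 + p.2 / R) * ω p.1) := funext huh
  rw [← forall_and]
  intro p
  refine (fun h => ⟨h, by rw [h]⟩) ?_
  have hωp : DifferentiableAt ℝ ω p.1 := hω.differentiable one_ne_zero p.1
  have hup := hu.differentiable one_ne_zero (p.1, p.2 + (1 + p.2 / R) * ω p.1)
  obtain ⟨hux, huy⟩ := fderiv_comp_aleMap R hωp hup.fst
  obtain ⟨-, hvy⟩ := fderiv_comp_aleMap R hωp hup.snd
  rw [hux, huy, hvy]
  have hR' := hR.ne'
  have hRω := (hpos p.1).ne'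
  field_simp
  ring
end

section
/- Generalized equicontinuity estimate (the new quantitative step behind the 'Generalized Aubin–Lions Compactness Result II'): Let (H, ‖·‖) be a normed real vector space, let N be a positive integer, T > 0, Δt := T/N, and let 1 ≤ p < 2 and C₀, A, B ≥ 0. Let d₀, …, d_{N−1} ∈ H and nonnegative reals a₀, …, a_{N−1} and b₀, …, b_N satisfy Δt·Σ_{n=0}^{N−1} aₙ² ≤ A², Δt·Σ_{n=0}^{N} bₙ² ≤ B², and ‖dₙ‖ ≤ C₀·(aₙ + bₙ + b_{n+1})^p for all n = 0, …, N−1. Then there exists a constant C₁, depending only on C₀, A, B and p (and in particular independent of N, Δt, n and l), such that for all integers n ≥ 0 and l ≥ 1 with n + l ≤ N: ‖ Δt·Σ_{j=n}^{n+l−1} dⱼ ‖ ≤ C₁ · (l·Δt)^{1 − p/2}. -/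
/-- Hölder's inequality against the constant function `1`, for a sum with uniform weight `τ`. -/
theorem mul_sum_rpow_le_rpow_mul_card_rpow {ι : Type*} (s : Finset ι) {f : ι → ℝ} {p τ : ℝ}
    (hp : 0 < p) (hp2 : p < 2) (hτ : 0 < τ) (hf : ∀ i ∈ s, 0 ≤ f i) :
    τ * ∑ i ∈ s, f i ^ p ≤
      (τ * ∑ i ∈ s, f i ^ 2) ^ (p / 2) * ((s.card : ℝ) * τ) ^ (1 - p / 2) := by
  have hconj : (2 / p).HolderConjugate (2 / (2 - p)) := by
    rw [Real.holderConjugate_iff]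
    refine ⟨(one_lt_div hp).2 hp2, ?_⟩
    rw [inv_div, inv_div]
    ring
  have holder := Real.inner_le_Lp_mul_Lq_of_nonneg s hconj (f := fun i => f i ^ p)
    (g := fun _ => 1) (fun i hi => Real.rpow_nonneg (hf i hi) p) (fun _ _ => zero_le_one)
  have hpow : ∑ i ∈ s, (f i ^ p) ^ (2 / p) = ∑ i ∈ s, f i ^ 2 := by
    refine Finset.sum_congr rfl fun i hi => ?_
    rw [← Real.rpow_mul (hf i hi), mul_div_cancel₀ _ hp.ne', Real.rpow_two]
  have hexp : (2 - p) / 2 = 1 - p / 2 := by ring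
  simp only [mul_one, hpow, Real.one_rpow, Finset.sum_const, nsmul_eq_mul, one_div_div, hexp]
    at holder
  have hsq : 0 ≤ ∑ i ∈ s, f i ^ 2 := Finset.sum_nonneg fun i _ => sq_nonneg (f i)
  have hsplit : τ ^ (p / 2) * τ ^ (1 - p / 2) = τ := by
    rw [← Real.rpow_add hτ, add_sub_cancel, Real.rpow_one]
  calc τ * ∑ i ∈ s, f i ^ p
      ≤ τ * ((∑ i ∈ s, f i ^ 2) ^ (p / 2) * (s.card : ℝ) ^ (1 - p / 2)) := by gcongr
    _ = (τ ^ (p / 2) * τ ^ (1 - p / 2)) *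
          ((∑ i ∈ s, f i ^ 2) ^ (p / 2) * (s.card : ℝ) ^ (1 - p / 2)) := by rw [hsplit]
    _ = _ := by
      rw [Real.mul_rpow hτ.le hsq, Real.mul_rpow (Nat.cast_nonneg _) hτ.le]
      ring

/-- Generalized equicontinuity estimate behind the generalized Aubin–Lions
compactness result II. -/
theorem generalized_equicontinuity
    {H : Type*} [NormedAddCommGroup H] [NormedSpace ℝ H]
    (p C₀ A B : ℝ) (hp1 : 1 ≤ p) (hp2 : p < 2)
    (hC₀ : 0 ≤ C₀) (hA : 0 ≤ A) (hB : 0 ≤ B) :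
    ∃ C₁ : ℝ, ∀ N : ℕ, 0 < N → ∀ T : ℝ, 0 < T →
      ∀ d : ℕ → H, ∀ a b : ℕ → ℝ,
      (∀ n < N, 0 ≤ a n) → (∀ n ≤ N, 0 ≤ b n) →
      ((T / (N:ℝ)) * ∑ n ∈ Finset.range N, (a n) ^ 2 ≤ A ^ 2) →
      ((T / (N:ℝ)) * ∑ n ∈ Finset.range (N + 1), (b n) ^ 2 ≤ B ^ 2) →
      (∀ n < N, ‖d n‖ ≤ C₀ * (a n + b n + b (n + 1)) ^ p) →
      ∀ n l : ℕ, 1 ≤ l → n + l ≤ N →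
        ‖(T / (N:ℝ)) • ∑ j ∈ Finset.Ico n (n + l), d j‖
          ≤ C₁ * ((l : ℝ) * (T / (N:ℝ))) ^ (1 - p / 2) := by
  refine ⟨C₀ * (3 * A ^ 2 + 6 * B ^ 2) ^ (p / 2), ?_⟩
  intro N hN T hT d a b ha hb hasum hbsum hd n l _ hnl
  have hτ : 0 < T / (N : ℝ) := div_pos hT (Nat.cast_pos.2 hN)
  generalize T / (N : ℝ) = τ at *
  set s := Finset.Ico n (n + l) with hs
  have hlt : ∀ j ∈ s, j < N := fun j hj => (Finset.mem_Ico.1 hj).2.trans_le hnl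
  have hf : ∀ j ∈ s, 0 ≤ a j + b j + b (j + 1) := fun j hj =>
    add_nonneg (add_nonneg (ha j (hlt j hj)) (hb j (hlt j hj).le)) (hb (j + 1) (hlt j hj))
  have hsub : s ⊆ Finset.range N := fun j hj => Finset.mem_range.2 (hlt j hj)
  have hsumA : ∑ j ∈ s, a j ^ 2 ≤ ∑ j ∈ Finset.range N, a j ^ 2 :=
    Finset.sum_le_sum_of_subset_of_nonneg hsub fun _ _ _ => sq_nonneg _
  have hsumB : ∑ j ∈ s, b j ^ 2 ≤ ∑ j ∈ Finset.range (N + 1), b j ^ 2 :=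
    Finset.sum_le_sum_of_subset_of_nonneg
      (hsub.trans (Finset.range_mono N.le_succ)) fun _ _ _ => sq_nonneg _
  have hsumB' : ∑ j ∈ s, b (j + 1) ^ 2 ≤ ∑ j ∈ Finset.range (N + 1), b j ^ 2 := by
    rw [Finset.sum_range_succ']
    exact (Finset.sum_le_sum_of_subset_of_nonneg hsub fun _ _ _ => sq_nonneg _).trans
      (le_add_of_nonneg_right (sq_nonneg _))
  have hsquares : τ * ∑ j ∈ s, (a j + b j + b (j + 1)) ^ 2 ≤ 3 * A ^ 2 + 6 * B ^ 2 := by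
    calc τ * ∑ j ∈ s, (a j + b j + b (j + 1)) ^ 2
        ≤ τ * ∑ j ∈ s, 3 * (a j ^ 2 + b j ^ 2 + b (j + 1) ^ 2) := by
          gcongr with j
          nlinarith [sq_nonneg (a j - b j), sq_nonneg (a j - b (j + 1)),
            sq_nonneg (b j - b (j + 1))]
      _ = 3 * (τ * ∑ j ∈ s, a j ^ 2) + 3 * (τ * ∑ j ∈ s, b j ^ 2)
            + 3 * (τ * ∑ j ∈ s, b (j + 1) ^ 2) := by
          rw [← Finset.mul_sum, Finset.sum_add_distrib, Finset.sum_add_distrib]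
          ring
      _ ≤ 3 * A ^ 2 + 6 * B ^ 2 := by
          linarith [mul_le_mul_of_nonneg_left hsumA hτ.le, mul_le_mul_of_nonneg_left hsumB hτ.le,
            mul_le_mul_of_nonneg_left hsumB' hτ.le]
  have hcard : (s.card : ℝ) = l := by simp [hs]
  have hsq : 0 ≤ τ * ∑ j ∈ s, (a j + b j + b (j + 1)) ^ 2 :=
    mul_nonneg hτ.le (Finset.sum_nonneg fun _ _ => sq_nonneg _)
  calc ‖τ • ∑ j ∈ s, d j‖ = τ * ‖∑ j ∈ s, d j‖ := by
        rw [norm_smul, Real.norm_of_nonneg hτ.le]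
    _ ≤ τ * ∑ j ∈ s, C₀ * (a j + b j + b (j + 1)) ^ p := by
        gcongr
        exact norm_sum_le_of_le s fun j hj => hd j (hlt j hj)
    _ = C₀ * (τ * ∑ j ∈ s, (a j + b j + b (j + 1)) ^ p) := by
        rw [← Finset.mul_sum]
        ring
    _ ≤ C₀ * ((τ * ∑ j ∈ s, (a j + b j + b (j + 1)) ^ 2) ^ (p / 2)
          * ((s.card : ℝ) * τ) ^ (1 - p / 2)) := by
        exact mul_le_mul_of_nonneg_left
          (mul_sum_rpow_le_rpow_mul_card_rpow s (by linarith) hp2 hτ hf) hC₀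
    _ ≤ C₀ * ((3 * A ^ 2 + 6 * B ^ 2) ^ (p / 2) * ((s.card : ℝ) * τ) ^ (1 - p / 2)) := by
        gcongr
    _ = C₀ * (3 * A ^ 2 + 6 * B ^ 2) ^ (p / 2) * ((l : ℝ) * τ) ^ (1 - p / 2) := by
        rw [hcard, mul_assoc]
end
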